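/- Let T be a tree on n ≥ 2 vertices, let l be a leaf of T, and let T' = T - {l}. Then for every real q with |q| ≤ 1, the eigenvalues of L_{T'}^q interlace those of L_T^q: λ_1(L_T^q) ≥ λ_1(L_{T'}^q) ≥ λ_2(L_T^q) ≥ λ_2(L_{T'}^q) ≥ ... ≥ λ_{n-1}(L_{T'}^q) ≥ λ_n(L_T^q) ≥ 0, where eigenvalues are listed in decreasing order. -/

import Mathlib

open Matrix SimpleGraph

/- The `q`-Laplacian of a graph: `I + q^2 (D - I) - q A`, where `D` is the diagonal
degree matrix and `A` the adjacency matrix. -/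
open Classical in
noncomputable def qLap {V : Type*} [Fintype V] [DecidableEq V]
    (G : SimpleGraph V) (q : ℝ) : Matrix V V ℝ :=
  1 + q ^ 2 • (Matrix.diagonal (fun i => ((G.neighborSet i).ncard : ℝ)) - 1)
    - q • Matrix.of (fun i j => if G.Adj i j then (1 : ℝ) else 0)

theorem dotProduct_qLap_mulVec {V : Type*} [Fintype V] [DecidableEq V]
    (G : SimpleGraph V) (q : ℝ) (x : V → ℝ) :
    x ⬝ᵥ (qLap G q *ᵥ x) = (1 - q ^ 2) * ∑ i, x i ^ 2 +
      ∑ i, ∑ j, (open Classical in if G.Adj i j then (1 : ℝ) else 0) *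
        (q ^ 2 * x i ^ 2 - q * (x i * x j)) := by
  classical
  have hdeg : ∀ i, ((G.neighborSet i).ncard : ℝ) = ∑ j, if G.Adj i j then (1 : ℝ) else 0 := by
    intro i
    rw [Set.ncard_eq_toFinset_card']
    simp
  rw [Finset.mul_sum, ← Finset.sum_add_distrib, dotProduct]
  refine Finset.sum_congr rfl fun i _ => ?_
  have h : (qLap G q *ᵥ x) i = x i + q ^ 2 * (((G.neighborSet i).ncard : ℝ) * x i - x i) -
      q * ∑ j, (if G.Adj i j then (1 : ℝ) else 0) * x j := by
    simp only [qLap, sub_mulVec, add_mulVec, smul_mulVec, one_mulVec, Pi.sub_apply, Pi.add_apply,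
      Pi.smul_apply, mulVec_diagonal, smul_eq_mul]
    simp only [mulVec, dotProduct, of_apply]
  rw [h, hdeg]
  simp only [mul_sub, Finset.sum_sub_distrib]
  rw [← Finset.sum_mul, Finset.mul_sum, Finset.mul_sum]
  have h' : ∑ j, (if G.Adj i j then (1 : ℝ) else 0) * (q * (x i * x j)) =
      x i * ∑ j, q * ((if G.Adj i j then (1 : ℝ) else 0) * x j) := by
    rw [Finset.mul_sum]
    exact Finset.sum_congr rfl fun j _ => by ring
  rw [h', Finset.mul_sum]
  ring

theorem qLap_isHermitian {V : Type*} [Fintype V] [DecidableEq V]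
    (G : SimpleGraph V) (q : ℝ) : (qLap G q).IsHermitian := by
  ext i j
  rcases eq_or_ne i j with rfl | h
  · simp
  · by_cases hij : G.Adj i j
    · simp [qLap, h, h.symm, hij, hij.symm]
    · simp [qLap, h, h.symm, hij, mt Adj.symm hij]

theorem sum_eq_add_sum_subtype_ne {V : Type*} [Fintype V] (l : V) [Fintype {v | v ≠ l}]
    (f : V → ℝ) : ∑ i, f i = f l + ∑ i : {v | v ≠ l}, f i := by
  classical
  rw [← Finset.add_sum_erase _ f (Finset.mem_univ l)]
  congr 1
  exact Finset.sum_subtype _ (by simp) f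

theorem dotProduct_qLap_mulVec_leaf {V : Type*} [Fintype V] [DecidableEq V]
    (G : SimpleGraph V) {l p : V} [Fintype {v | v ≠ l}] [DecidableEq {v | v ≠ l}]
    (hp : ∀ v, G.Adj l v ↔ v = p) (q : ℝ) (x : V → ℝ) :
    x ⬝ᵥ (qLap G q *ᵥ x) =
      (fun i : {v | v ≠ l} => x i) ⬝ᵥ
        (qLap (G.induce {v | v ≠ l}) q *ᵥ fun i : {v | v ≠ l} => x i) +
      (x l - q * x p) ^ 2 := by
  classical
  have hpl : p ≠ l := fun h => G.loopless.irrefl l ((hp l).2 h.symm)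
  have hp' : ∀ v, G.Adj v l ↔ v = p := fun v => by rw [G.adj_comm, hp]
  rw [dotProduct_qLap_mulVec, dotProduct_qLap_mulVec, sum_eq_add_sum_subtype_ne l,
    sum_eq_add_sum_subtype_ne l]
  have h1 : ∑ j, (if G.Adj l j then (1 : ℝ) else 0) *
      (q ^ 2 * x l ^ 2 - q * (x l * x j)) = q ^ 2 * x l ^ 2 - q * (x l * x p) := by
    simp [hp]
  have h2 : ∑ i : {v | v ≠ l}, (if G.Adj i l then (1 : ℝ) else 0) *
      (q ^ 2 * x i ^ 2 - q * (x i * x l)) = q ^ 2 * x p ^ 2 - q * (x p * x l) := by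
    rw [Finset.sum_eq_single ⟨p, hpl⟩]
    · simp [hp']
    · intro b _ hb
      have : ¬ (b : V) = p := fun h => hb (Subtype.ext h)
      simp [hp', this]
    · simp
  have h3 : ∀ i : {v | v ≠ l}, ∑ j, (if G.Adj i j then (1 : ℝ) else 0) *
      (q ^ 2 * x i ^ 2 - q * (x i * x j)) =
      (if G.Adj i l then (1 : ℝ) else 0) * (q ^ 2 * x i ^ 2 - q * (x i * x l)) +
      ∑ j : {v | v ≠ l}, (if G.Adj i j then (1 : ℝ) else 0) *
        (q ^ 2 * x i ^ 2 - q * (x i * x j)) := fun i => sum_eq_add_sum_subtype_ne l _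
  rw [h1, Finset.sum_congr rfl fun i _ => h3 i, Finset.sum_add_distrib, h2]
  simp only [comap_adj, Function.Embedding.subtype_apply]
  ring

theorem exists_adj_iff_eq_of_ncard_neighborSet_eq_one {V : Type*} {G : SimpleGraph V} {l : V}
    (hl : (G.neighborSet l).ncard = 1) : ∃ p, ∀ v, G.Adj l v ↔ v = p := by
  obtain ⟨p, hp⟩ := Set.ncard_eq_one.1 hl
  exact ⟨p, fun v => by rw [← mem_neighborSet, hp, Set.mem_singleton_iff]⟩

theorem dotProduct_qLap_mulVec_nonneg {q : ℝ} (hq : |q| ≤ 1) (n : ℕ) :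
    ∀ {V : Type} [Fintype V] [DecidableEq V] (G : SimpleGraph V), G.IsTree →
      Fintype.card V = n + 1 → ∀ x : V → ℝ, 0 ≤ x ⬝ᵥ (qLap G q *ᵥ x) := by
  classical
  have hq2 : 0 ≤ 1 - q ^ 2 := by
    have := (sq_le_one_iff_abs_le_one q).2 hq
    linarith
  induction n with
  | zero =>
    intro V _ _ G _ hc x
    have : Subsingleton V := Fintype.card_le_one_iff_subsingleton.1 hc.le
    have hadj : ∀ i j, ¬ G.Adj i j := fun i j h => h.ne (Subsingleton.elim i j)
    rw [dotProduct_qLap_mulVec]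
    simp only [hadj, if_false, zero_mul, Finset.sum_const_zero, add_zero]
    exact mul_nonneg hq2 (Finset.sum_nonneg fun i _ => sq_nonneg _)
  | succ n ih =>
    intro V _ _ G hG hc x
    have : Nontrivial V := Fintype.one_lt_card_iff_nontrivial.1 (by omega)
    obtain ⟨l, hl⟩ := hG.exists_vert_degree_one_of_nontrivial
    obtain ⟨p, hp, hp'⟩ := degree_eq_one_iff_existsUnique_adj.1 hl
    rw [dotProduct_qLap_mulVec_leaf G (l := l) (p := p) fun v => ⟨hp' v, fun h => h ▸ hp⟩]
    refine add_nonneg (ih _ ⟨?_, hG.isAcyclic.induce _⟩ ?_ _) (sq_nonneg _)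
    · exact hG.connected.induce_compl_singleton_of_degree_eq_one hl
    · have := Set.card_ne_eq l
      omega

/-- Coordinates with respect to an orthonormal eigenbasis, in which a symmetric matrix is diagonal
with its ordered eigenvalues on the diagonal. -/
theorem exists_linearEquiv_diagonalizing {V : Type*} [Fintype V] [DecidableEq V]
    {A : Matrix V V ℝ} (hA : A.IsHermitian) {N : ℕ} (hN : Fintype.card V = N)
    {μ : Fin N → ℝ} (hμ : Antitone μ) (hroots : A.charpoly.roots = ↑(List.ofFn μ)) :
    ∃ e : (V → ℝ) →ₗ[ℝ] (Fin N → ℝ), (∀ x, x ⬝ᵥ x = ∑ k, e x k ^ 2) ∧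
      ∀ x, x ⬝ᵥ (A *ᵥ x) = ∑ k, μ k * e x k ^ 2 := by
  subst hN
  have hμ₀ : μ = hA.eigenvalues₀ := by
    apply List.ofFn_injective
    refine List.Perm.eq_of_sortedGE hμ.sortedGE_ofFn hA.eigenvalues₀_antitone.sortedGE_ofFn ?_
    rw [← Multiset.coe_eq_coe, ← hroots, hA.roots_charpoly_eq_eigenvalues₀, Fin.univ_val_map]
    rfl
  subst hμ₀
  let σ : Fin (Fintype.card V) ≃ V := Fintype.equivOfCardEq (Fintype.card_fin _)
  let b := hA.eigenvectorBasis
  have hinner : ∀ x y : V → ℝ, x ⬝ᵥ y = ∑ k, (x ⬝ᵥ b k) * (y ⬝ᵥ b k) := by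
    intro x y
    have h := b.sum_inner_mul_inner (WithLp.toLp 2 y) (WithLp.toLp 2 x)
    simp only [EuclideanSpace.inner_eq_star_dotProduct, star_trivial] at h
    rw [← h]
    refine Finset.sum_congr rfl fun k _ => ?_
    rw [dotProduct_comm (b k).ofLp y, mul_comm]
  let e : (V → ℝ) →ₗ[ℝ] (Fin (Fintype.card V) → ℝ) :=
    LinearMap.pi fun k => (dotProductBilin ℝ ℝ).flip (b (σ k)).ofLp
  have he : ∀ x k, e x k = x ⬝ᵥ b (σ k) := fun x k => rfl
  refine ⟨e, fun x => ?_, fun x => ?_⟩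
  · rw [hinner, ← σ.sum_comp]
    exact Finset.sum_congr rfl fun k _ => by rw [he, sq]
  · rw [hinner, ← σ.sum_comp]
    refine Finset.sum_congr rfl fun k _ => ?_
    have h1 : (A *ᵥ x) ⬝ᵥ b (σ k) = hA.eigenvalues₀ k * (x ⬝ᵥ b (σ k)) := by
      have hT : Aᵀ = A := hA
      rw [dotProduct_comm, dotProduct_mulVec, ← mulVec_transpose, hT,
        hA.mulVec_eigenvectorBasis, smul_dotProduct, dotProduct_comm]
      simp [IsHermitian.eigenvalues, σ, b]
    rw [h1, he]
    ring

theorem dotProduct_mulVec_le_of_eq_zero {V : Type*} [Fintype V] {A : Matrix V V ℝ} {N : ℕ}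
    {μ : Fin N → ℝ} (hμ : Antitone μ) {x : V → ℝ} {y : Fin N → ℝ}
    (h1 : x ⬝ᵥ x = ∑ k, y k ^ 2) (h2 : x ⬝ᵥ (A *ᵥ x) = ∑ k, μ k * y k ^ 2)
    {i : Fin N} (h : ∀ k < i, y k = 0) : x ⬝ᵥ (A *ᵥ x) ≤ μ i * (x ⬝ᵥ x) := by
  rw [h1, h2, Finset.mul_sum]
  refine Finset.sum_le_sum fun k _ => ?_
  rcases lt_or_ge k i with hk | hk
  · simp [h k hk]
  · exact mul_le_mul_of_nonneg_right (hμ hk) (sq_nonneg _)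

theorem le_dotProduct_mulVec_of_eq_zero {V : Type*} [Fintype V] {A : Matrix V V ℝ} {N : ℕ}
    {μ : Fin N → ℝ} (hμ : Antitone μ) {x : V → ℝ} {y : Fin N → ℝ}
    (h1 : x ⬝ᵥ x = ∑ k, y k ^ 2) (h2 : x ⬝ᵥ (A *ᵥ x) = ∑ k, μ k * y k ^ 2)
    {i : Fin N} (h : ∀ k, i < k → y k = 0) : μ i * (x ⬝ᵥ x) ≤ x ⬝ᵥ (A *ᵥ x) := by
  rw [h1, h2, Finset.mul_sum]
  refine Finset.sum_le_sum fun k _ => ?_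
  rcases lt_or_ge i k with hk | hk
  · simp [h k hk]
  · exact mul_le_mul_of_nonneg_right (hμ hk) (sq_nonneg _)

theorem exists_ne_zero_forall_eq_zero {V : Type*} [Fintype V] {n : ℕ} (hn : n < Fintype.card V)
    (f : Fin n → (V → ℝ) →ₗ[ℝ] ℝ) : ∃ x ≠ 0, ∀ k, f k x = 0 := by
  have h : LinearMap.ker (LinearMap.pi f) ≠ ⊥ :=
    LinearMap.ker_ne_bot_of_finrank_lt (by simpa using hn)
  obtain ⟨x, hx, hx0⟩ := (Submodule.ne_bot_iff _).1 h
  exact ⟨x, hx0, fun k => congrFun (LinearMap.mem_ker.1 hx) k⟩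

theorem dotProduct_self_pos_of_ne_zero {V : Type*} [Fintype V] {x : V → ℝ} (hx : x ≠ 0) :
    0 < x ⬝ᵥ x := by
  simpa using dotProduct_self_star_pos_iff.2 hx

/- Interlacing after deleting a leaf, for `|q| ≤ 1`.  Here `μ` (resp. `μ'`) is the
antitone (decreasing) enumeration of the eigenvalues, with multiplicity, of the
`q`-Laplacian of the tree `G` on `m+2` vertices (resp. of `G` with the leaf `l` deleted). -/
theorem qLap_leaf_interlacing_of_abs_le_one {m : ℕ}
    (G : SimpleGraph (Fin (m + 2))) (hT : G.IsTree)
    (l : Fin (m + 2)) (hl : (G.neighborSet l).ncard = 1)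
    (q : ℝ) (hq : |q| ≤ 1)
    (μ : Fin (m + 2) → ℝ) (hμ : Antitone μ)
    (hroots : (qLap G q).charpoly.roots = ↑(List.ofFn μ))
    (μ' : Fin (m + 1) → ℝ) (hμ' : Antitone μ')
    (hroots' : (qLap (G.induce {v | v ≠ l}) q).charpoly.roots = ↑(List.ofFn μ')) :
    (∀ i : Fin (m + 1), μ i.castSucc ≥ μ' i ∧ μ' i ≥ μ i.succ) ∧
      0 ≤ μ (Fin.last (m + 1)) := by
  obtain ⟨p, hp⟩ := exists_adj_iff_eq_of_ncard_neighborSet_eq_one hl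
  have hpl : p ≠ l := fun h => G.loopless.irrefl l ((hp l).2 h.symm)
  have hcard : Fintype.card {v | v ≠ l} = m + 1 := by
    have := Set.card_ne_eq l
    simpa using this
  obtain ⟨e, he1, he2⟩ :=
    exists_linearEquiv_diagonalizing (qLap_isHermitian G q) (Fintype.card_fin _) hμ hroots
  obtain ⟨e', he1', he2'⟩ :=
    exists_linearEquiv_diagonalizing (qLap_isHermitian (G.induce {v | v ≠ l}) q) hcard hμ' hroots'
  have hsplit := dotProduct_qLap_mulVec_leaf G hp q
  have hdot : ∀ x : Fin (m + 2) → ℝ, x ⬝ᵥ x = x l ^ 2 +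
      (fun i : {v | v ≠ l} => x i) ⬝ᵥ (fun i : {v | v ≠ l} => x i) := fun x => by
    simp only [dotProduct]
    rw [sum_eq_add_sum_subtype_ne l, sq]
  have hpsd := dotProduct_qLap_mulVec_nonneg hq (m + 1) G hT (Fintype.card_fin _)
  have hnonneg : 0 ≤ μ (Fin.last (m + 1)) := by
    obtain ⟨x, hx, hx0⟩ := exists_ne_zero_forall_eq_zero (V := Fin (m + 2)) (n := m + 1) (by simp)
      fun k => LinearMap.proj k.castSucc ∘ₗ e
    have h := dotProduct_mulVec_le_of_eq_zero hμ (he1 x) (he2 x) (i := Fin.last (m + 1))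
      fun k hk => by simpa using hx0 (k.castPred hk.ne)
    exact nonneg_of_mul_nonneg_left ((hpsd x).trans h) (dotProduct_self_pos_of_ne_zero hx)
  refine ⟨fun i => ⟨?_, ?_⟩, hnonneg⟩
  · let ext0 : ({v | v ≠ l} → ℝ) →ₗ[ℝ] (Fin (m + 2) → ℝ) :=
      LinearMap.pi fun j => if h : j ≠ l then LinearMap.proj ⟨j, h⟩ else 0
    obtain ⟨y, hy, hy0⟩ := exists_ne_zero_forall_eq_zero (V := {v | v ≠ l}) (n := m)
      (by rw [hcard]; exact m.lt_succ_self) fun k =>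
        if k.castSucc < i then LinearMap.proj k.castSucc.castSucc ∘ₗ e ∘ₗ ext0
        else LinearMap.proj k.succ ∘ₗ e'
    have hres : (fun j : {v | v ≠ l} => ext0 y j) = y := by
      funext j
      have hj : (j : Fin (m + 2)) ≠ l := j.2
      simp [ext0, hj]
    have hl0 : ext0 y l = 0 := by simp [ext0]
    have hlow := le_dotProduct_mulVec_of_eq_zero hμ' (he1' y) (he2' y) (i := i) fun k hk => by
      obtain ⟨k, rfl⟩ := Fin.exists_succ_eq.2 (Fin.ne_zero_of_lt hk)
      have hk' : ¬ k.castSucc < i := fun h => (Fin.lt_def.1 h).not_ge (Nat.lt_succ_iff.1 hk)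
      simpa [hk'] using hy0 k
    have hup := dotProduct_mulVec_le_of_eq_zero hμ (he1 (ext0 y)) (he2 (ext0 y)) (i := i.castSucc)
      fun k hk => by
        obtain ⟨k, rfl⟩ : ∃ k' : Fin m, k'.castSucc.castSucc = k :=
          ⟨⟨k, by have := i.2; simp only [Fin.lt_def, Fin.val_castSucc] at hk; omega⟩, rfl⟩
        have hk' : k.castSucc < i := hk
        simpa [hk'] using hy0 k
    rw [hsplit, hdot, hres, hl0] at hup
    refine le_of_mul_le_mul_right (a := y ⬝ᵥ y) ?_ (dotProduct_self_pos_of_ne_zero hy)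
    nlinarith [sq_nonneg (0 - q * ext0 y p)]
  · let res : (Fin (m + 2) → ℝ) →ₗ[ℝ] ({v | v ≠ l} → ℝ) := LinearMap.funLeft ℝ ℝ Subtype.val
    obtain ⟨x, hx, hx0⟩ := exists_ne_zero_forall_eq_zero (V := Fin (m + 2)) (n := m + 1)
      (by simp) fun k =>
        if k < i then LinearMap.proj k ∘ₗ e' ∘ₗ res
        else if k = i then LinearMap.proj l - q • LinearMap.proj p
        else LinearMap.proj k.succ ∘ₗ e
    have hxl : x l - q * x p = 0 := by simpa using hx0 i
    have hlow := le_dotProduct_mulVec_of_eq_zero hμ (he1 x) (he2 x) (i := i.succ) fun k hk => by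
      obtain ⟨k, rfl⟩ := Fin.exists_succ_eq.2 (Fin.ne_zero_of_lt hk)
      have hk' : i < k := Fin.succ_lt_succ_iff.1 hk
      simpa [hk'.not_gt, hk'.ne'] using hx0 k
    have hup := dotProduct_mulVec_le_of_eq_zero hμ' (he1' (res x)) (he2' (res x)) (i := i)
      fun k hk => by simpa [hk] using hx0 k
    have hres : (fun j : {v | v ≠ l} => x j) = res x := rfl
    rw [hsplit, hdot, hres, hxl] at hlow
    have hne : res x ≠ 0 := by
      intro h0
      apply hx
      have h' : ∀ j, j ≠ l → x j = 0 := fun j hj => congrFun h0 ⟨j, hj⟩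
      funext j
      by_cases hj : j = l
      · rw [hj, Pi.zero_apply]
        simpa [h' p hpl] using hxl
      · exact h' j hj
    have hnn : 0 ≤ μ i.succ := hnonneg.trans (hμ (Fin.le_last _))
    refine le_of_mul_le_mul_right (a := res x ⬝ᵥ res x) ?_ (dotProduct_self_pos_of_ne_zero hne)
    nlinarith [mul_nonneg hnn (sq_nonneg (x l))]
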